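/- Let m, d ≥ 1 and N ≥ 1. Let π = (π_1,…,π_m) be a probability vector, and for each site ℓ ∈ {1,…,N} let {A^{[ℓ]}_k}_{k=1}^d be m×m complex matrices satisfying the gauge condition ∑_{k=1}^d A^{[ℓ]}_k (A^{[ℓ]}_k)† = I_m. Then ∑_{k_1,…,k_N=1}^{d} πᵀ · ((A^{[1]}_{k_1} ⋄ conj(A^{[1]}_{k_1})) ⋯ (A^{[N]}_{k_N} ⋄ conj(A^{[N]}_{k_N}))) · 𝟙 = 1, where 𝟙 is the all-ones column vector in ℂ^m. -/

import Mathlib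

open Matrix

theorem sum_prod_ofFn_eq_prod_ofFn_sum {R κ : Type*} [Semiring R] [Fintype κ] :
    ∀ {N : ℕ} (B : Fin N → κ → R),
      ∑ kv : Fin N → κ, (List.ofFn fun ℓ => B ℓ (kv ℓ)).prod =
        (List.ofFn fun ℓ => ∑ k, B ℓ k).prod
  | 0, B => by simp
  | N + 1, B => by
    rw [← (Fin.consEquiv fun _ : Fin (N + 1) => κ).sum_comp, Fintype.sum_prod_type]
    simp only [Fin.consEquiv_apply, List.ofFn_succ, List.prod_cons, Fin.cons_zero, Fin.cons_succ]
    rw [← sum_prod_ofFn_eq_prod_ofFn_sum fun ℓ => B ℓ.succ, Finset.sum_mul_sum]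

theorem list_prod_mulVec_eq_self {R n : Type*} [Semiring R] [Fintype n] [DecidableEq n]
    (v : n → R) (L : List (Matrix n n R)) (hL : ∀ M ∈ L, M *ᵥ v = v) : L.prod *ᵥ v = v := by
  induction L with
  | nil => simp
  | cons M L ih =>
    rw [List.prod_cons, ← mulVec_mulVec, ih fun M' h => hL M' (List.mem_cons_of_mem _ h),
      hL M List.mem_cons_self]

theorem sum_hadamard_conj_mulVec_one {κ n : Type*} [Fintype κ] [Fintype n] [DecidableEq n]
    (A : κ → Matrix n n ℂ) (hA : ∑ k, A k * (A k)ᴴ = 1) :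
    (∑ k, hadamard (A k) ((A k).map (starRingEnd ℂ))) *ᵥ (fun _ => (1 : ℂ)) = fun _ => 1 := by
  ext i
  have h := congrFun (congrFun hA i) i
  simp only [Matrix.sum_apply, mul_apply, conjTranspose_apply, one_apply_eq] at h
  rw [sum_mulVec, Finset.sum_apply]
  simpa [mulVec, dotProduct] using h

/-- the observation density matrix `ρ_{O;N}` has unit trace: the diagonal
entries `πᵀ ((A^{[1]}_{k_1} ⋄ conj A^{[1]}_{k_1}) ⋯ (A^{[N]}_{k_N} ⋄ conj A^{[N]}_{k_N})) 𝟙`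
sum to 1 over all tuples `(k_1,…,k_N)`. -/
theorem stmt_5 (m d N : ℕ) (hm : 1 ≤ m) (hd : 1 ≤ d) (hN : 1 ≤ N)
    (π : Fin m → ℝ) (hπ0 : ∀ i, 0 ≤ π i) (hπ1 : ∑ i, π i = 1)
    (A : Fin N → Fin d → Matrix (Fin m) (Fin m) ℂ)
    (hA : ∀ ℓ, ∑ k, A ℓ k * (A ℓ k)ᴴ = 1) :
    ∑ kv : Fin N → Fin d,
      (fun i => (π i : ℂ)) ⬝ᵥ
        ((List.ofFn fun ℓ : Fin N =>
            Matrix.hadamard (A ℓ (kv ℓ)) ((A ℓ (kv ℓ)).map (starRingEnd ℂ))).prod.mulVec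
          fun _ => (1 : ℂ)) = 1 := by
  rw [← dotProduct_sum, ← sum_mulVec,
    sum_prod_ofFn_eq_prod_ofFn_sum fun ℓ k => hadamard (A ℓ k) ((A ℓ k).map (starRingEnd ℂ)),
    list_prod_mulVec_eq_self]
  · simp only [dotProduct, mul_one]
    exact_mod_cast hπ1
  · intro M hM
    obtain ⟨ℓ, rfl⟩ := (List.mem_ofFn' _ _).1 hM
    exact sum_hadamard_conj_mulVec_one (A ℓ) (hA ℓ)
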